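/- For each n ≥ 1 there exist two non-isomorphic connected graphs with self-loops on 24n vertices, each having 12n looped vertices, whose self-loop energies are both equal to 24n − 4 + 4√(36n²+1). -/

import Mathlib

open Matrix Finset

/-- Diagonal 0/1 indicator matrix of the loop set `S`. -/
def loopDiag {V : Type} [Fintype V] [DecidableEq V] (S : Finset V) : Matrix V V ℝ :=
  Matrix.diagonal (fun v => if v ∈ S then (1 : ℝ) else 0)

lemma adjMatrix_isHermitian {V : Type} [Fintype V] [DecidableEq V]
    (G : SimpleGraph V) [DecidableRel G.Adj] :
    (SimpleGraph.adjMatrix ℝ G).IsHermitian := by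
  rw [Matrix.IsHermitian, conjTranspose_eq_transpose_of_trivial]
  exact G.isSymm_adjMatrix

lemma selfLoop_isHermitian {V : Type} [Fintype V] [DecidableEq V]
    (G : SimpleGraph V) [DecidableRel G.Adj] (S : Finset V) :
    (SimpleGraph.adjMatrix ℝ G + loopDiag S).IsHermitian :=
  (adjMatrix_isHermitian G).add (Matrix.isHermitian_diagonal _)

/-- The energy of the self-loop graph `G_S`: `∑ i, |λᵢ(A(G)+D_S) - |S|/n|`. -/
noncomputable def selfLoopEnergy {V : Type} [Fintype V] [DecidableEq V]
    (G : SimpleGraph V) [DecidableRel G.Adj] (S : Finset V) : ℝ :=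
  ∑ i, |(selfLoop_isHermitian G S).eigenvalues i - (S.card : ℝ) / (Fintype.card V)|

/-- Two self-loop graphs `(G₁, S₁)` and `(G₂, S₂)` are isomorphic if some vertex
bijection carries adjacency to adjacency and the loop set to the loop set. -/
def SelfLoopIso {V : Type} (G₁ G₂ : SimpleGraph V) (S₁ S₂ : Finset V) : Prop :=
  ∃ e : V ≃ V, (∀ u v, G₁.Adj u v ↔ G₂.Adj (e u) (e v)) ∧ (∀ v, v ∈ S₁ ↔ e v ∈ S₂)


open scoped MatrixOrder ComplexOrder in
lemma sqrt_unique_aux {ι : Type} [Fintype ι] [DecidableEq ι] (C D : Matrix ι ι ℝ)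
    (hC : C.PosSemidef) (hD : D.PosSemidef) (h : C * C = D * D) : C = D := by
  have h1 := CFC.sqrt_unique h hC.nonneg
  have h2 := CFC.sqrt_unique (rfl : D * D = D * D) hD.nonneg
  exact h1.symm.trans h2

open scoped MatrixOrder ComplexOrder in
lemma psd_factor {ι : Type} [Fintype ι] [DecidableEq ι] (C : Matrix ι ι ℝ)
    (hC : C.PosSemidef) : ∃ B : Matrix ι ι ℝ, C = Bᴴ * B :=
  CStarAlgebra.nonneg_iff_eq_star_mul_self.mp hC.nonneg

lemma energy_trace {ι : Type} [Fintype ι] [DecidableEq ι] (M : Matrix ι ι ℝ)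
    (hM : M.IsHermitian) (c : ℝ) (C : Matrix ι ι ℝ) (hC : C.PosSemidef)
    (h : C * C = (M - c • (1 : Matrix ι ι ℝ)) * (M - c • (1 : Matrix ι ι ℝ))) :
    ∑ i, |hM.eigenvalues i - c| = C.trace := by
  let U : Matrix ι ι ℝ := hM.eigenvectorUnitary
  have hU1 : U * star U = 1 := Unitary.coe_mul_star_self _
  have hU2 : star U * U = 1 := Unitary.coe_star_mul_self _
  have hsp : M = U * diagonal hM.eigenvalues * star U := by
    have := hM.spectral_theorem
    rw [Unitary.conjStarAlgAut_apply] at this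
    simpa using this
  have hMc : M - c • (1 : Matrix ι ι ℝ) =
      U * diagonal (fun i => hM.eigenvalues i - c) * star U := by
    have : diagonal (fun i => hM.eigenvalues i - c) =
        diagonal hM.eigenvalues - c • (1 : Matrix ι ι ℝ) := by
      rw [smul_one_eq_diagonal, diagonal_sub]
    rw [this, mul_sub, sub_mul, ← hsp]
    simp [hU1]
  let D : Matrix ι ι ℝ := U * diagonal (fun i => |hM.eigenvalues i - c|) * star U
  have hD : D.PosSemidef :=
    (PosSemidef.diagonal (fun i => abs_nonneg _)).mul_mul_conjTranspose_same U
  have hDD : D * D = (M - c • (1 : Matrix ι ι ℝ)) * (M - c • (1 : Matrix ι ι ℝ)) := by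
    have key : ∀ f : ι → ℝ, (U * diagonal f * star U) * (U * diagonal f * star U) =
        U * diagonal (fun i => f i * f i) * star U := by
      intro f
      calc _ = U * diagonal f * (star U * U) * diagonal f * star U := by
            simp only [Matrix.mul_assoc]
        _ = _ := by rw [hU2, Matrix.mul_one, Matrix.mul_assoc U, diagonal_mul_diagonal]
    rw [hMc, key, key]
    simp
  rw [sqrt_unique_aux C D hC hD (h.trans hDD.symm)]
  show _ = trace (U * diagonal (fun i => |hM.eigenvalues i - c|) * star U)
  rw [trace_mul_comm, ← Matrix.mul_assoc, hU2, Matrix.one_mul, trace_diagonal]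

lemma block_lemma {κ : Type} [Fintype κ] [DecidableEq κ] (m k : ℝ)
    (hm : 0 < m) (hcard : (Fintype.card κ : ℝ) = m)
    (P A K : Matrix κ κ ℝ) (hPP : P * P = P) (hPt : Pᴴ = P) (hPtr : P.trace = 1)
    (hAP : A * P = (7/2 : ℝ) • P) (hPA : P * A = (7/2 : ℝ) • P)
    (hKP : K * P = (7/2 : ℝ) • P) (hPK : P * K = (7/2 : ℝ) • P)
    (hK : K.PosSemidef) (hKA : K * K = A * A) (hKtr : K.trace = k) :
    ∃ C : Matrix (κ ⊕ κ) (κ ⊕ κ) ℝ, C.PosSemidef ∧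
      C * C = fromBlocks ((-1/2 : ℝ) • (1 : Matrix κ κ ℝ)) (m • P) (m • P) A *
        fromBlocks ((-1/2 : ℝ) • (1 : Matrix κ κ ℝ)) (m • P) (m • P) A ∧
      C.trace = m / 2 + k - 4 + 2 * Real.sqrt (m ^ 2 + 4) := by
  set r := Real.sqrt (m ^ 2 + 4) with hr
  have hr2 : r * r = m ^ 2 + 4 := Real.mul_self_sqrt (by positivity)
  have hr0 : 0 < r := Real.sqrt_pos.mpr (by positivity)
  have hQQ : (1 - P) * (1 - P) = 1 - P := by
    simp [mul_sub, sub_mul, hPP]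
  have hQt : (1 - P)ᴴ = 1 - P := by rw [conjTranspose_sub, hPt, conjTranspose_one]
  have hps : ∀ X : Matrix κ κ ℝ, X.PosSemidef → ∀ Y : Matrix κ κ ℝ, Y.PosSemidef →
      (fromBlocks X 0 0 Y).PosSemidef := by
    intro X hX Y hY
    obtain ⟨B, rfl⟩ := psd_factor _ hX
    obtain ⟨D, rfl⟩ := psd_factor _ hY
    have := posSemidef_conjTranspose_mul_self (fromBlocks B 0 0 D)
    rw [fromBlocks_conjTranspose, fromBlocks_multiply] at this
    simpa using this
  have hP : P.PosSemidef := by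
    have := posSemidef_conjTranspose_mul_self P
    rwa [hPt, hPP] at this
  have hQ : (1 - P).PosSemidef := by
    have := posSemidef_conjTranspose_mul_self (1 - P)
    rwa [hQt, hQQ] at this
  have hKQ : (K - (7/2 : ℝ) • P).PosSemidef := by
    have := hK.conjTranspose_mul_mul_same (1 - P)
    rw [hQt] at this
    convert this using 1
    simp [mul_sub, sub_mul, hPK, hKP, hPP]
  let Bc : Matrix (κ ⊕ κ) (κ ⊕ κ) ℝ :=
    fromBlocks ((-1/2 : ℝ) • P) (m • P) (m • P) ((7/2 : ℝ) • P)
  have hBc : (Bcᴴ * Bc).PosSemidef := posSemidef_conjTranspose_mul_self _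
  have hBcBc : Bcᴴ * Bc = fromBlocks ((1/4 + m^2) • P) ((3 * m) • P) ((3 * m) • P)
      ((49/4 + m^2) • P) := by
    simp only [Bc, fromBlocks_conjTranspose, fromBlocks_multiply, conjTranspose_smul, hPt,
      smul_mul_assoc, mul_smul_comm, hPP, smul_smul, ← add_smul, star_trivial]
    congr 2 <;> ring
  let C : Matrix (κ ⊕ κ) (κ ⊕ κ) ℝ := fromBlocks
    ((1/2 : ℝ) • (1 - P) + ((m^2+1)/r) • P) ((3*m/(2*r)) • P) ((3*m/(2*r)) • P)
    (K - (7/2 : ℝ) • P + ((m^2+7)/r) • P)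
  have hCe : C = fromBlocks ((1/2 : ℝ) • (1 - P)) 0 0 (K - (7/2 : ℝ) • P) +
      (1/(2*r)) • (Bcᴴ * Bc + (m^2+7/4) • fromBlocks P 0 0 P) := by
    rw [hBcBc]
    simp only [C, fromBlocks_smul, fromBlocks_add, smul_zero, add_zero, zero_add, ← add_smul,
      smul_smul]
    congr 3 <;> · congr 1; field_simp; try ring
  refine ⟨C, ?_, ?_, ?_⟩
  · rw [hCe]
    refine (hps _ (hQ.smul (by norm_num)) _ hKQ).add (PosSemidef.smul (hBc.add
      ((hps _ hP _ hP).smul (by positivity))) (by positivity))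
  · simp only [C, fromBlocks_multiply, mul_add, add_mul, mul_sub, sub_mul,
      smul_mul_assoc, mul_smul_comm, hPP, hKP, hPK, hKA, hAP, hPA, smul_smul, smul_add, smul_sub,
      mul_one, one_mul]
    congr 1
    · match_scalars <;> field_simp <;> nlinarith
    · match_scalars <;> field_simp <;> nlinarith
    · match_scalars <;> field_simp <;> nlinarith
    · match_scalars <;> field_simp <;> nlinarith
  · have htf : C.trace = ((1/2 : ℝ) • (1 - P) + ((m^2+1)/r) • P).trace +
        (K - (7/2 : ℝ) • P + ((m^2+7)/r) • P).trace := by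
      simp only [C, Matrix.trace, Fintype.sum_sum_type, diag_apply, fromBlocks_apply₁₁,
        fromBlocks_apply₂₂]
    simp only [htf, trace_add, trace_sub, trace_smul, trace_one, hPtr, hKtr,
      hcard, smul_eq_mul]
    field_simp
    nlinarith


def mate1 : Fin 12 → Fin 12 := ![3,4,5,0,1,2,9,10,11,6,7,8]
def mate2 : Fin 12 → Fin 12 := ![3,6,9,0,7,10,1,4,11,2,5,8]
def hAdj (f : Fin 12 → Fin 12) (i j : Fin 12) : Bool :=
  (i.val / 3 == j.val / 3 && i != j) || f i == j
def hMat (f : Fin 12 → Fin 12) : Matrix (Fin 12) (Fin 12) ℤ :=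
  fun i j => if hAdj f i j then 1 else 0
def L1 : Matrix (Fin 12) (Fin 12) ℤ := fun i j =>
  if i.val / 6 = j.val / 6 then
    if i = j then 36 else if mate1 i = j then 0 else 12 else 0
def L2 : Matrix (Fin 12) (Fin 12) ℤ :=
 !![36, 13, 13, 4, 7, 7, 7, -3, -2, 7, -3, -2;
    13, 36, 13, 7, -3, -2, 4, 7, 7, 7, -2, -3;
    13, 13, 36, 7, -2, -3, 7, -2, -3, 4, 7, 7;
    4, 7, 7, 36, 13, 13, -3, 7, -2, -3, 7, -2;
    7, -3, -2, 13, 36, 13, 7, 4, 7, -2, 7, -3;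
    7, -2, -3, 13, 13, 36, -2, 7, -3, 7, 4, 7;
    7, 4, 7, -3, 7, -2, 36, 13, 13, -3, -2, 7;
    -3, 7, -2, 7, 4, 7, 13, 36, 13, -2, -3, 7;
    -2, 7, -3, -2, 7, -3, 13, 13, 36, 7, 7, 4;
    7, 7, 4, -3, -2, 7, -3, -2, 7, 36, 13, 13;
    -3, -2, 7, 7, 7, 4, -2, -3, 7, 13, 36, 13;
    -2, -3, 7, -2, -3, 7, 7, 7, 4, 13, 13, 36]

structure Cert (f : Fin 12 → Fin 12) (L : Matrix (Fin 12) (Fin 12) ℤ) : Prop where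
  symmA : ∀ i j, hAdj f i j = hAdj f j i
  irr : ∀ i, hAdj f i i = false
  rowA : ∀ i, ∑ j, hMat f i j = 3
  symmL : Lᵀ = L
  rowL : ∀ i, ∑ j, L i j = 84
  trL : ∑ i, L i i = 432
  sq : ∀ i j, ∑ k, L i k * L k j = ∑ k, 144 * ((2 * hMat f i k + if i = k then 1 else 0) *
     (2 * hMat f k j + if k = j then 1 else 0))
  psd : 110592 • L = 1152 • (L * L) + 1161216 • 1 +
    (L * L - 96 • L + 1008 • 1) * (L * L - 96 • L + 1008 • 1)

set_option maxRecDepth 100000 in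
lemma cert1 : Cert mate1 L1 := by
  constructor <;> decide +kernel
set_option maxRecDepth 100000 in
lemma cert2 : Cert mate2 L2 := by
  constructor <;> decide +kernel
lemma no4 : ∀ a b, hAdj mate2 a b → ∀ c, hAdj mate2 b c → a ≠ c → ∀ d, hAdj mate2 c d → b ≠ d →
   ¬ hAdj mate2 d a := by decide +kernel

def realA (f : Fin 12 → Fin 12) : Matrix (Fin 12) (Fin 12) ℝ :=
  (hMat f).map (Int.castRingHom ℝ)

lemma cert_psd {f L} (h : Cert f L) :
    ((1/24 : ℝ) • (L.map (Int.castRingHom ℝ))).PosSemidef := by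
  set R : Matrix (Fin 12) (Fin 12) ℝ := L.map (Int.castRingHom ℝ) with hR
  have hRt : Rᴴ = R := by
    have := congrArg (fun M : Matrix (Fin 12) (Fin 12) ℤ => M.map (Int.castRingHom ℝ)) h.symmL
    simpa [hR, transpose_map] using this
  have h1 := congrArg (Int.castRingHom ℝ).mapMatrix h.psd
  simp only [map_nsmul, map_add, map_mul, map_sub, map_one, RingHom.mapMatrix_apply, ← hR] at h1
  set W := R * R - 96 • R + 1008 • (1 : Matrix (Fin 12) (Fin 12) ℝ) with hW
  have hWt : Wᴴ = W := by
    simp only [hW, conjTranspose_add, conjTranspose_sub, conjTranspose_mul, conjTranspose_smul, hRt,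
      conjTranspose_one, star_trivial]
  have p1 := posSemidef_conjTranspose_mul_self R
  have p2 := posSemidef_conjTranspose_mul_self W
  rw [hRt] at p1
  rw [hWt] at p2
  have p3 : (1 : Matrix (Fin 12) (Fin 12) ℝ).PosSemidef := PosSemidef.one
  have h2 : (1/24 : ℝ) • R = (1/2654208 : ℝ) •
      ((1152 : ℝ) • (R * R) + (1161216 : ℝ) • (1 : Matrix (Fin 12) (Fin 12) ℝ) + W * W) := by
    have : (1152 : ℝ) • (R * R) + (1161216 : ℝ) • (1 : Matrix (Fin 12) (Fin 12) ℝ) + W * W =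
      (110592 : ℝ) • R := by
      rw [← Nat.cast_smul_eq_nsmul ℝ, ← Nat.cast_smul_eq_nsmul ℝ, ← Nat.cast_smul_eq_nsmul ℝ] at h1
      exact_mod_cast h1.symm
    rw [this, smul_smul]
    norm_num
  rw [h2]
  exact PosSemidef.smul (((p1.smul (by norm_num)).add (p3.smul (by norm_num))).add p2)
    (by norm_num)

lemma cert_sq {f L} (h : Cert f L) :
    ((1/24 : ℝ) • (L.map (Int.castRingHom ℝ))) * ((1/24 : ℝ) • (L.map (Int.castRingHom ℝ))) =
    (realA f + (1/2 : ℝ) • 1) * (realA f + (1/2 : ℝ) • 1) := by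
  ext i j
  have h1 := congrArg (Int.cast : ℤ → ℝ) (h.sq i j)
  push_cast at h1
  simp only [Matrix.mul_apply, Matrix.smul_apply, Matrix.add_apply, Matrix.one_apply, realA,
    Matrix.map_apply, smul_eq_mul]
  have e1 : ∀ x, (1/24 * (Int.castRingHom ℝ) (L i x)) * (1/24 * (Int.castRingHom ℝ) (L x j)) =
    (1/576) * ((L i x : ℝ) * (L x j : ℝ)) := by intro x; simp; ring
  rw [Finset.sum_congr rfl (fun x _ => e1 x), ← Finset.mul_sum, h1, Finset.mul_sum]
  refine Finset.sum_congr rfl (fun x _ => ?_)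
  simp only [eq_intCast]
  ring

open scoped Kronecker

abbrev VV (n : ℕ) := (Fin n × Fin 12) ⊕ (Fin n × Fin 12)

def vAdj (f : Fin 12 → Fin 12) (n : ℕ) : VV n → VV n → Prop
  | .inl _, .inl _ => False
  | .inl _, .inr _ => True
  | .inr _, .inl _ => True
  | .inr a, .inr b => a.1 = b.1 ∧ hAdj f a.2 b.2 = true

def vGraph {f L} (h : Cert f L) (n : ℕ) : SimpleGraph (VV n) where
  Adj := vAdj f n
  symm := ⟨by
    rintro (a | a) (b | b) hab
    · exact hab
    · trivial
    · trivial
    · exact ⟨hab.1.symm, by rw [h.symmA]; exact hab.2⟩⟩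
  loopless := ⟨by
    rintro (a | a) hab
    · exact hab
    · have := hab.2
      rw [h.irr] at this
      exact absurd this (by decide)⟩

noncomputable def eqv (n : ℕ) : VV n ≃ Fin (24 * n) :=
  Fintype.equivFinOfCardEq (by simp; ring)

noncomputable def GG {f L} (h : Cert f L) (n : ℕ) : SimpleGraph (Fin (24 * n)) :=
  (vGraph h n).comap (eqv n).symm

noncomputable def SS (n : ℕ) : Finset (Fin (24 * n)) :=
  (univ : Finset (Fin n × Fin 12)).map (Function.Embedding.inr.trans (eqv n).toEmbedding)

lemma mem_SS (n : ℕ) (v : Fin (24 * n)) : v ∈ SS n ↔ ∃ a, (eqv n).symm v = Sum.inr a := by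
  simp only [SS, Finset.mem_map, Finset.mem_univ, true_and]
  constructor
  · rintro ⟨a, rfl⟩; exact ⟨a, by simp⟩
  · rintro ⟨a, ha⟩; exact ⟨a, by simp [← ha]⟩

lemma card_SS (n : ℕ) : (SS n).card = 12 * n := by
  simp [SS]; ring

lemma GG_conn {f L} (h : Cert f L) (n : ℕ) (hn : 1 ≤ n) : (GG h n).Connected := by
  have h0 : (vGraph h n).Connected := by
    let o : Fin n × Fin 12 := (⟨0, hn⟩, 0)
    have lr : ∀ a b, (vGraph h n).Reachable (.inl a) (.inr b) := fun a b =>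
      SimpleGraph.Adj.reachable (show (vGraph h n).Adj (.inl a) (.inr b) from trivial)
    haveI : Nonempty (VV n) := ⟨.inl o⟩
    refine SimpleGraph.Connected.mk ?_
    have key : ∀ x, (vGraph h n).Reachable (.inl o) x := by
      rintro (a | a)
      · exact (lr o o).trans (lr a o).symm
      · exact lr o a
    exact fun x y => (key x).symm.trans (key y)
  exact (SimpleGraph.Iso.connected_iff (SimpleGraph.Iso.comap (eqv n).symm (vGraph h n))).mpr h0

lemma GG_energy {f L} (h : Cert f L) (n : ℕ) (hn : 1 ≤ n) :
    @selfLoopEnergy _ _ _ (GG h n) (Classical.decRel _) (SS n)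
        = 24 * n - 4 + 4 * Real.sqrt (36 * n ^ 2 + 1) := by
  have hn0 : (0 : ℝ) < n := by exact_mod_cast hn
  set m : ℝ := 12 * n with hm
  have hm0 : 0 < m := by positivity
  have hcard : (Fintype.card (Fin n × Fin 12) : ℝ) = m := by simp [hm]; ring
  let P : Matrix (Fin n × Fin 12) (Fin n × Fin 12) ℝ := fun _ _ => 1 / m
  have hPa : ∀ a b, P a b = 1 / m := fun _ _ => rfl
  let A₀ : Matrix (Fin 12) (Fin 12) ℝ := realA f + (1/2 : ℝ) • 1
  let K₀ : Matrix (Fin 12) (Fin 12) ℝ := (1/24 : ℝ) • (L.map (Int.castRingHom ℝ))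
  have hA0s : A₀ᵀ = A₀ := by
    ext i j
    simp [A₀, realA, hMat, h.symmA i j, Matrix.one_apply, eq_comm (a := i) (b := j)]
  have hK0s : K₀ᵀ = K₀ := by
    ext i j
    have := congrFun (congrFun h.symmL i) j
    simp only [transpose_apply] at this
    simp [K₀, this]
  have hA0r : ∀ i, ∑ j, A₀ i j = 7/2 := by
    intro i
    have := congrArg (Int.cast : ℤ → ℝ) (h.rowA i)
    push_cast at this
    simp [A₀, realA, Finset.sum_add_distrib, this, Matrix.one_apply]
    norm_num
  have hK0r : ∀ i, ∑ j, K₀ i j = 7/2 := by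
    intro i
    have := congrArg (Int.cast : ℤ → ℝ) (h.rowL i)
    push_cast at this
    simp [K₀, ← Finset.mul_sum, this]
    norm_num
  have gR : ∀ X : Matrix (Fin 12) (Fin 12) ℝ, (∀ i, ∑ j, X i j = 7/2) →
      ((1 : Matrix (Fin n) (Fin n) ℝ) ⊗ₖ X) * P = (7/2 : ℝ) • P := by
    intro X hX
    ext ⟨a, i⟩ ⟨b, j⟩
    simp only [Matrix.mul_apply, hPa, Matrix.smul_apply, ← Finset.sum_mul, kroneckerMap_apply,
      Fintype.sum_prod_type, smul_eq_mul, ← Finset.mul_sum, hX]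
    simp [Matrix.one_apply, hX]
  have gL : ∀ X : Matrix (Fin 12) (Fin 12) ℝ, Xᵀ = X → (∀ i, ∑ j, X i j = 7/2) →
      P * ((1 : Matrix (Fin n) (Fin n) ℝ) ⊗ₖ X) = (7/2 : ℝ) • P := by
    intro X hXt hX
    have := congrArg transpose (gR X hX)
    have hPt : Pᵀ = P := rfl
    rw [transpose_mul, ← kroneckerMap_transpose, transpose_one, hXt, transpose_smul, hPt] at this
    exact this
  obtain ⟨C, hC, hCC, hCt⟩ := block_lemma m (18 * n) hm0 hcard P (1 ⊗ₖ A₀) (1 ⊗ₖ K₀)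
    (by
      ext a b
      simp only [Matrix.mul_apply, hPa, Finset.sum_const, Finset.card_univ, nsmul_eq_mul, hcard]
      field_simp)
    (by ext a b; simp [hPa])
    (by
      simp only [Matrix.trace, hPa, diag_apply, Finset.sum_const, Finset.card_univ, nsmul_eq_mul,
        hcard]
      field_simp)
    (gR _ hA0r) (gL _ hA0s hA0r) (gR _ hK0r) (gL _ hK0s hK0r)
    (PosSemidef.one.kronecker (cert_psd h))
    (by
      rw [← mul_kronecker_mul, ← mul_kronecker_mul]
      exact congrArg (fun M => _ ⊗ₖ M) (cert_sq h))
    (by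
      rw [trace_kronecker, trace_one]
      have := congrArg (Int.cast : ℤ → ℝ) h.trL
      push_cast at this
      simp [K₀, Matrix.trace, ← Finset.mul_sum, this]
      ring)
  letI := Classical.decRel (GG h n).Adj
  have hadj : ∀ u v, SimpleGraph.adjMatrix ℝ (GG h n) (eqv n u) (eqv n v) =
      @ite _ (vAdj f n u v) (Classical.propDecidable _) (1 : ℝ) 0 := by
    intro u v
    rw [SimpleGraph.adjMatrix_apply]
    have : (GG h n).Adj (eqv n u) (eqv n v) ↔ vAdj f n u v := by
      simp [GG, vGraph]
    by_cases hv : vAdj f n u v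
    · rw [if_pos (this.mpr hv), if_pos hv]
    · rw [if_neg (fun h' => hv (this.mp h')), if_neg hv]
  have hMB : SimpleGraph.adjMatrix ℝ (GG h n) + loopDiag (SS n)
      - ((1/2 : ℝ) • (1 : Matrix (Fin (24 * n)) (Fin (24 * n)) ℝ)) =
      (fromBlocks ((-1/2 : ℝ) • (1 : Matrix (Fin n × Fin 12) (Fin n × Fin 12) ℝ)) (m • P) (m • P)
        (1 ⊗ₖ A₀)).submatrix (eqv n).symm (eqv n).symm := by
    ext u v
    obtain ⟨u, rfl⟩ := (eqv n).surjective u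
    obtain ⟨v, rfl⟩ := (eqv n).surjective v
    have hmm : m * m⁻¹ = 1 := by field_simp
    simp only [Matrix.sub_apply, Matrix.add_apply, hadj, loopDiag,
      diagonal_apply, mem_SS, Matrix.smul_apply, Matrix.one_apply, submatrix_apply,
      Equiv.symm_apply_apply, EmbeddingLike.apply_eq_iff_eq]
    rcases u with ⟨a, i⟩ | ⟨a, i⟩ <;> rcases v with ⟨b, j⟩ | ⟨b, j⟩
    · simp [vAdj, Matrix.one_apply]
      split_ifs <;> norm_num
    · simp [vAdj, hPa, hmm]
    · simp [vAdj, hPa, hmm]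
    · by_cases hab : a = b
      · by_cases hij : i = j
        · subst hab hij
          simp [vAdj, A₀, realA, hMat, h.irr]; norm_num
        · simp [vAdj, A₀, realA, hMat, hab, hij]
      · simp [vAdj, hab]
  have hratio : ((SS n).card : ℝ) / (Fintype.card (Fin (24 * n))) = 1/2 := by
    rw [card_SS, Fintype.card_fin]; push_cast; field_simp; norm_num
  unfold selfLoopEnergy
  rw [hratio, energy_trace _ _ (1/2) (C.submatrix (eqv n).symm (eqv n).symm)
    (hC.submatrix _) (by rw [hMB, submatrix_mul_equiv, submatrix_mul_equiv, hCC])]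
  have ht : (C.submatrix (eqv n).symm (eqv n).symm).trace = C.trace := by
    simp only [Matrix.trace, diag_apply, submatrix_apply]
    exact Equiv.sum_comp (eqv n).symm (fun i => C i i)
  rw [ht, hCt]
  have : Real.sqrt (m ^ 2 + 4) = 2 * Real.sqrt (36 * n ^ 2 + 1) := by
    rw [show m ^ 2 + 4 = 2 ^ 2 * (36 * (n : ℝ) ^ 2 + 1) by rw [hm]; ring,
      Real.sqrt_mul (by positivity), Real.sqrt_sq (by norm_num)]
  rw [this, hm]
  ring

lemma not_iso (n : ℕ) (hn : 1 ≤ n) : ¬ SelfLoopIso (GG cert1 n) (GG cert2 n) (SS n) (SS n) := by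
  rintro ⟨e, hadj, hS⟩
  have ex : ∀ i : Fin 12, ∃ a, (eqv n).symm (e (eqv n (.inr (⟨0, hn⟩, i)))) = Sum.inr a := by
    intro i
    rw [← mem_SS, ← hS, mem_SS]
    exact ⟨_, by simp; rfl⟩
  choose g hg using ex
  have hgi : ∀ i j, g i = g j → i = j := by
    intro i j hij
    have := (hg i).trans ((congrArg Sum.inr hij).trans (hg j).symm)
    simpa using this
  have hga : ∀ i j, hAdj mate1 i j = true →
      (g i).1 = (g j).1 ∧ hAdj mate2 (g i).2 (g j).2 = true := by
    intro i j hij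
    have h1 : (GG cert1 n).Adj (eqv n (.inr (⟨0, hn⟩, i))) (eqv n (.inr (⟨0, hn⟩, j))) := by
      show vAdj mate1 n _ _
      simp [vAdj, hij]
    have h2 : vAdj mate2 n _ _ := (hadj _ _).mp h1
    rw [hg, hg] at h2
    exact h2
  have a01 := hga 0 1 (by decide)
  have a14 := hga 1 4 (by decide)
  have a43 := hga 4 3 (by decide)
  have a30 := hga 3 0 (by decide)
  refine no4 _ _ a01.2 _ a14.2 ?_ _ a43.2 ?_ a30.2
  · intro h
    exact absurd (hgi 0 4 (Prod.ext (a01.1.trans a14.1) h)) (by decide)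
  · intro h
    exact absurd (hgi 1 3 (Prod.ext (a14.1.trans a43.1) h)) (by decide)

/-- For every `n ≥ 1` there exist two non-isomorphic connected self-loop graphs on
`24n` vertices, each with `12n` looped vertices, both of energy
`24n − 4 + 4√(36n²+1)`. -/
theorem exists_equienergetic_selfLoopGraphs (n : ℕ) (hn : 1 ≤ n) :
    ∃ (G₁ G₂ : SimpleGraph (Fin (24 * n))) (S₁ S₂ : Finset (Fin (24 * n))),
      G₁.Connected ∧ G₂.Connected ∧ S₁.card = 12 * n ∧ S₂.card = 12 * n ∧
      ¬ SelfLoopIso G₁ G₂ S₁ S₂ ∧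
      @selfLoopEnergy _ _ _ G₁ (Classical.decRel _) S₁
        = 24 * n - 4 + 4 * Real.sqrt (36 * n ^ 2 + 1) ∧
      @selfLoopEnergy _ _ _ G₂ (Classical.decRel _) S₂
        = 24 * n - 4 + 4 * Real.sqrt (36 * n ^ 2 + 1) := by
  exact ⟨GG cert1 n, GG cert2 n, SS n, SS n, GG_conn _ n hn, GG_conn _ n hn, card_SS n, card_SS n,
    not_iso n hn, GG_energy _ n hn, GG_energy _ n hn⟩
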